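/- Under the hypotheses of Uhlmann's lemma (β : A₁ → A₂ unital completely positive, S₁,T₁ ∈ A₁⁺, S₂,T₂ ∈ A₂⁺ with Tᵢ invertible, tr(S₂β(a)) ≤ tr(S₁a) and tr(T₂β(a)) ≤ tr(T₁a) for all a ∈ A₁⁺), one has tr(S₂^μ T₂^{1−μ}) ≤ tr(S₁^μ T₁^{1−μ}) for all 0 ≤ μ ≤ 1. -/

import Mathlib

open Matrix
open scoped ComplexOrder

/-- The canonical embedding of a `k × k` matrix with entries in a star subalgebra
`A ⊆ M_n(ℂ)` into `M_{k·n}(ℂ)`, used to express complete positivity. -/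
def toBig {n k : ℕ} {A : StarSubalgebra ℂ (Matrix (Fin n) (Fin n) ℂ)}
    (M : Matrix (Fin k) (Fin k) A) : Matrix (Fin k × Fin n) (Fin k × Fin n) ℂ :=
  fun p q => (↑(M p.1 q.1) : Matrix (Fin n) (Fin n) ℂ) p.2 q.2

/-- A linear map between finite-dimensional C*-algebras is completely positive if all
its matrix amplifications are positive. -/
def IsCompletelyPositive {n m : ℕ}
    {A₁ : StarSubalgebra ℂ (Matrix (Fin n) (Fin n) ℂ)}
    {A₂ : StarSubalgebra ℂ (Matrix (Fin m) (Fin m) ℂ)}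
    (β : A₁ →ₗ[ℂ] A₂) : Prop :=
  ∀ (k : ℕ) (M : Matrix (Fin k) (Fin k) A₁),
    (toBig M).PosSemidef → (toBig (M.map fun a => β a)).PosSemidef

section UhlmannAux

/-- Integrating the parallel-sum inequalities gives the inequality for the powers. -/
lemma uhl_scalar {ι κ : Type} [Fintype ι] [Fintype κ] (s t w : ι → ℝ) (s' t' w' : κ → ℝ)
    (hs : ∀ i, 0 ≤ s i) (ht : ∀ i, 0 < t i) (hs' : ∀ i, 0 ≤ s' i) (ht' : ∀ i, 0 < t' i)
    (h : ∀ ρ : ℝ, 0 < ρ → ∑ i, ρ * s i * t i / (s i + ρ * t i) * w i ≤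
      ∑ i, ρ * s' i * t' i / (s' i + ρ * t' i) * w' i)
    {p : ℝ} (hp : p ∈ Set.Ioo (0 : ℝ) 1) :
    ∑ i, s i ^ p * t i ^ (1 - p) * w i ≤ ∑ i, s' i ^ p * t' i ^ (1 - p) * w' i := by
  have key : ∀ {α : Type} [Fintype α] (s t w : α → ℝ), (∀ i, 0 ≤ s i) → (∀ i, 0 < t i) →
      MeasureTheory.IntegrableOn
        (fun ρ => ∑ i, Real.rpowIntegrand₀₁ p ρ (s i / t i) * (t i * w i)) (Set.Ioi 0) ∧
      ∫ ρ in Set.Ioi (0 : ℝ), (∑ i, Real.rpowIntegrand₀₁ p ρ (s i / t i) * (t i * w i)) =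
        (∑ i, s i ^ p * t i ^ (1 - p) * w i) *
          ∫ ρ in Set.Ioi (0 : ℝ), Real.rpowIntegrand₀₁ p ρ 1 := by
    intro α _ s t w hs ht
    have hI : ∀ i, MeasureTheory.IntegrableOn
        (fun ρ => Real.rpowIntegrand₀₁ p ρ (s i / t i) * (t i * w i)) (Set.Ioi 0) := fun i =>
      (Real.integrableOn_rpowIntegrand₀₁_Ioi hp (div_nonneg (hs i) (ht i).le)).mul_const _
    refine ⟨MeasureTheory.integrable_finsetSum _ fun i _ => hI i, ?_⟩
    rw [MeasureTheory.integral_finsetSum _ fun i _ => hI i, Finset.sum_mul]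
    refine Finset.sum_congr rfl fun i _ => ?_
    rw [MeasureTheory.integral_mul_const,
      Real.integral_rpowIntegrand₀₁_eq_rpow_mul_const hp (div_nonneg (hs i) (ht i).le),
      Real.div_rpow (hs i) (ht i).le, Real.rpow_sub (ht i), Real.rpow_one]
    ring
  have pw : ∀ {α : Type} [Fintype α] (s t w : α → ℝ), (∀ i, 0 ≤ s i) → (∀ i, 0 < t i) →
      ∀ ρ : ℝ, 0 < ρ → ∑ i, Real.rpowIntegrand₀₁ p ρ (s i / t i) * (t i * w i) =
        ρ ^ (p - 1) / ρ * ∑ i, ρ * s i * t i / (s i + ρ * t i) * w i := by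
    intro α _ s t w hs ht ρ hρ
    rw [Finset.mul_sum]
    refine Finset.sum_congr rfl fun i _ => ?_
    rw [Real.rpowIntegrand₀₁_eq_pow_div hp hρ.le (div_nonneg (hs i) (ht i).le)]
    have h1 := hs i
    have h2 := ht i
    have h3 : s i + ρ * t i ≠ 0 := by positivity
    have h4 : ρ + s i / t i ≠ 0 := by positivity
    have h5 : ρ + s i / t i = (s i + ρ * t i) / t i := by field_simp; ring
    rw [h5]
    field_simp
  have k1 := key s t w hs ht
  have k2 := key s' t' w' hs' ht'
  refine le_of_mul_le_mul_right ?_ (Real.integral_rpowIntegrand₀₁_one_pos hp)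
  rw [← k1.2, ← k2.2]
  refine MeasureTheory.setIntegral_mono_on k1.1 k2.1 measurableSet_Ioi fun ρ hρ => ?_
  have hρ : 0 < ρ := hρ
  rw [pw s t w hs ht ρ hρ, pw s' t' w' hs' ht' ρ hρ]
  exact mul_le_mul_of_nonneg_left (h ρ hρ) (by positivity)

/-- The matrix of `y` in the eigenbases of `A` and `B`. -/
noncomputable def uhlW {n : ℕ} {A B : Matrix (Fin n) (Fin n) ℂ} (hA : A.IsHermitian)
    (hB : B.IsHermitian) (y : Matrix (Fin n) (Fin n) ℂ) : Matrix (Fin n) (Fin n) ℂ :=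
  (hA.eigenvectorUnitary : Matrix (Fin n) (Fin n) ℂ)ᴴ * y *
    (hB.eigenvectorUnitary : Matrix (Fin n) (Fin n) ℂ)

lemma uhl_cfc_eq {n : ℕ} {A : Matrix (Fin n) (Fin n) ℂ} (hA : A.IsHermitian) (f : ℝ → ℝ) :
    hA.cfc f = (hA.eigenvectorUnitary : Matrix (Fin n) (Fin n) ℂ) *
      diagonal (fun i => ((f (hA.eigenvalues i) : ℝ) : ℂ)) *
      (hA.eigenvectorUnitary : Matrix (Fin n) (Fin n) ℂ)ᴴ := by
  rw [IsHermitian.cfc, Unitary.conjStarAlgAut_apply]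
  rfl

lemma uhl_cfc_id {n : ℕ} {A : Matrix (Fin n) (Fin n) ℂ} (hA : A.IsHermitian) :
    hA.cfc (fun r => r) = A := by
  conv_rhs => rw [hA.spectral_theorem]
  rfl

lemma uhl_cfc_one {n : ℕ} {A : Matrix (Fin n) (Fin n) ℂ} (hA : A.IsHermitian) :
    hA.cfc (fun _ => 1) = 1 := by
  rw [uhl_cfc_eq]
  simp [← star_eq_conjTranspose]

lemma uhl_trace {n : ℕ} {A B : Matrix (Fin n) (Fin n) ℂ} (hA : A.IsHermitian)
    (hB : B.IsHermitian) (f g : ℝ → ℝ) (y : Matrix (Fin n) (Fin n) ℂ) :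
    (hA.cfc f * y * hB.cfc g * yᴴ).trace =
      ((∑ p : Fin n × Fin n, f (hA.eigenvalues p.1) * g (hB.eigenvalues p.2) *
        Complex.normSq (uhlW hA hB y p.1 p.2) : ℝ) : ℂ) := by
  rw [uhl_cfc_eq, uhl_cfc_eq]
  set U := (hA.eigenvectorUnitary : Matrix (Fin n) (Fin n) ℂ) with hU
  set V := (hB.eigenvectorUnitary : Matrix (Fin n) (Fin n) ℂ) with hV
  set D := diagonal (fun i => ((f (hA.eigenvalues i) : ℝ) : ℂ)) with hD
  set E := diagonal (fun i => ((g (hB.eigenvalues i) : ℝ) : ℂ)) with hE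
  have h1 : (U * D * Uᴴ * y * (V * E * Vᴴ) * yᴴ).trace =
      (D * uhlW hA hB y * (E * (uhlW hA hB y)ᴴ)).trace := by
    have : U * D * Uᴴ * y * (V * E * Vᴴ) * yᴴ = U * (D * Uᴴ * y * (V * E * Vᴴ) * yᴴ) := by
      simp only [Matrix.mul_assoc]
    rw [this, trace_mul_comm]
    simp only [uhlW, conjTranspose_mul, conjTranspose_conjTranspose, Matrix.mul_assoc, ← hU, ← hV]
  rw [h1, Fintype.sum_prod_type]
  simp only [trace, diag]
  simp_rw [Matrix.mul_apply (M := D * _)]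
  simp only [hD, hE, diagonal_mul, conjTranspose_apply]
  push_cast
  refine Finset.sum_congr rfl fun i _ => Finset.sum_congr rfl fun j _ => ?_
  rw [Complex.normSq_eq_conj_mul_self, RCLike.star_def]
  ring

/-- The quadratic form `tr(S y y*) + ρ tr(T z* z)`. -/
lemma uhl_quad {n : ℕ} {S T : Matrix (Fin n) (Fin n) ℂ} (hS : S.IsHermitian)
    (hT : T.IsHermitian) (ρ : ℝ) (y z : Matrix (Fin n) (Fin n) ℂ) :
    (S * (y * yᴴ)).trace + ρ * (T * (zᴴ * z)).trace =
      ((∑ p : Fin n × Fin n, (hS.eigenvalues p.1 * Complex.normSq (uhlW hS hT y p.1 p.2) +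
        ρ * hT.eigenvalues p.2 * Complex.normSq (uhlW hS hT z p.1 p.2)) : ℝ) : ℂ) := by
  have h1 := uhl_trace hS hT (fun r => r) (fun _ => 1) y
  have h2 := uhl_trace hS hT (fun _ => 1) (fun r => r) z
  rw [uhl_cfc_id, uhl_cfc_one] at h1 h2
  have e1 : (S * (y * yᴴ)).trace = (S * y * 1 * yᴴ).trace := by
    rw [Matrix.mul_one, Matrix.mul_assoc]
  have e2 : (T * (zᴴ * z)).trace = (1 * z * T * zᴴ).trace := by
    rw [Matrix.one_mul, ← Matrix.mul_assoc, trace_mul_comm, Matrix.mul_assoc]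
  rw [e1, e2, h1, h2]
  push_cast
  rw [Finset.mul_sum, ← Finset.sum_add_distrib]
  refine Finset.sum_congr rfl fun p _ => ?_
  ring

lemma uhlW_add {n : ℕ} {S T : Matrix (Fin n) (Fin n) ℂ} (hS : S.IsHermitian)
    (hT : T.IsHermitian) (y z : Matrix (Fin n) (Fin n) ℂ) :
    uhlW hS hT (y + z) = uhlW hS hT y + uhlW hS hT z := by
  simp [uhlW, Matrix.mul_add, Matrix.add_mul]

lemma uhl_ineq (s t : ℝ) (hs : 0 ≤ s) (ht : 0 < t) (a b : ℂ) :
    s * t / (s + t) * Complex.normSq (a + b) ≤ s * Complex.normSq a + t * Complex.normSq b := by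
  have h : 0 < s + t := by positivity
  rw [div_mul_eq_mul_div, div_le_iff₀ h]
  simp only [Complex.normSq_apply, Complex.add_re, Complex.add_im]
  nlinarith [sq_nonneg (s * a.re - t * b.re), sq_nonneg (s * a.im - t * b.im)]

lemma uhl_eq (s t : ℝ) (hs : 0 ≤ s) (ht : 0 < t) (a b : ℂ) (hab : (s : ℂ) * a = t * b) :
    s * Complex.normSq a + t * Complex.normSq b = s * t / (s + t) * Complex.normSq (a + b) := by
  have h : s + t ≠ 0 := by positivity
  have ht' : (t : ℂ) ≠ 0 := by exact_mod_cast ht.ne'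
  have hb : b = ((s / t : ℝ) : ℂ) * a := by
    push_cast
    field_simp
    rw [hab, mul_comm]
  have hb2 : a + b = ((1 + s / t : ℝ) : ℂ) * a := by
    rw [hb]; push_cast; ring
  rw [hb2, hb, Complex.normSq_mul, Complex.normSq_mul, Complex.normSq_ofReal,
    Complex.normSq_ofReal]
  have := ht.ne'
  field_simp
  ring

lemma uhl_lower {n : ℕ} {S T : Matrix (Fin n) (Fin n) ℂ} (hS : S.PosSemidef)
    (hT : T.PosDef) (ρ : ℝ) (hρ : 0 < ρ) (y z : Matrix (Fin n) (Fin n) ℂ) (h : y + z = 1) :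
    ((∑ p : Fin n × Fin n, ρ * hS.1.eigenvalues p.1 * hT.posSemidef.1.eigenvalues p.2 /
      (hS.1.eigenvalues p.1 + ρ * hT.posSemidef.1.eigenvalues p.2) *
        Complex.normSq (uhlW hS.1 hT.posSemidef.1 1 p.1 p.2) : ℝ) : ℂ) ≤
    (S * (y * yᴴ)).trace + ρ * (T * (zᴴ * z)).trace := by
  rw [uhl_quad hS.1 hT.posSemidef.1, Complex.real_le_real, ← h, uhlW_add]
  refine Finset.sum_le_sum fun p _ => ?_
  have := uhl_ineq (hS.1.eigenvalues p.1) (ρ * hT.posSemidef.1.eigenvalues p.2)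
    (hS.eigenvalues_nonneg _) (mul_pos hρ (hT.eigenvalues_pos _))
    (uhlW hS.1 hT.posSemidef.1 y p.1 p.2) (uhlW hS.1 hT.posSemidef.1 z p.1 p.2)
  refine le_trans (le_of_eq ?_) this
  rw [Matrix.add_apply]
  ring

lemma uhlW_left {n : ℕ} {S T : Matrix (Fin n) (Fin n) ℂ} (hS : S.IsHermitian)
    (hT : T.IsHermitian) (y : Matrix (Fin n) (Fin n) ℂ) (i j : Fin n) :
    uhlW hS hT (S * y) i j = (hS.eigenvalues i : ℂ) * uhlW hS hT y i j := by
  have hU : (hS.eigenvectorUnitary : Matrix (Fin n) (Fin n) ℂ)ᴴ *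
      (hS.eigenvectorUnitary : Matrix (Fin n) (Fin n) ℂ) = 1 := by simp [← star_eq_conjTranspose]
  have h : uhlW hS hT (S * y) = diagonal (fun i => (hS.eigenvalues i : ℂ)) * uhlW hS hT y := by
    have h0 := uhl_cfc_eq hS (fun r => r)
    rw [uhl_cfc_id] at h0
    have h1 : (hS.eigenvectorUnitary : Matrix (Fin n) (Fin n) ℂ)ᴴ * S =
        diagonal (fun i => (hS.eigenvalues i : ℂ)) *
          (hS.eigenvectorUnitary : Matrix (Fin n) (Fin n) ℂ)ᴴ := by
      calc _ = (hS.eigenvectorUnitary : Matrix (Fin n) (Fin n) ℂ)ᴴ *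
          ((hS.eigenvectorUnitary : Matrix (Fin n) (Fin n) ℂ) *
            diagonal (fun i => (hS.eigenvalues i : ℂ)) *
            (hS.eigenvectorUnitary : Matrix (Fin n) (Fin n) ℂ)ᴴ) := congrArg _ h0
        _ = _ := by rw [← Matrix.mul_assoc, ← Matrix.mul_assoc, hU, Matrix.one_mul]
    rw [uhlW, ← Matrix.mul_assoc, h1, uhlW]
    simp only [Matrix.mul_assoc]
  rw [h, diagonal_mul]

lemma uhlW_right {n : ℕ} {S T : Matrix (Fin n) (Fin n) ℂ} (hS : S.IsHermitian)
    (hT : T.IsHermitian) (y : Matrix (Fin n) (Fin n) ℂ) (i j : Fin n) :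
    uhlW hS hT (y * T) i j = (hT.eigenvalues j : ℂ) * uhlW hS hT y i j := by
  have hV : (hT.eigenvectorUnitary : Matrix (Fin n) (Fin n) ℂ)ᴴ *
      (hT.eigenvectorUnitary : Matrix (Fin n) (Fin n) ℂ) = 1 := by simp [← star_eq_conjTranspose]
  have h : uhlW hS hT (y * T) = uhlW hS hT y * diagonal (fun i => (hT.eigenvalues i : ℂ)) := by
    have h0 := uhl_cfc_eq hT (fun r => r)
    rw [uhl_cfc_id] at h0
    have h1 : T * (hT.eigenvectorUnitary : Matrix (Fin n) (Fin n) ℂ) =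
        (hT.eigenvectorUnitary : Matrix (Fin n) (Fin n) ℂ) *
          diagonal (fun i => (hT.eigenvalues i : ℂ)) := by
      calc _ = ((hT.eigenvectorUnitary : Matrix (Fin n) (Fin n) ℂ) *
            diagonal (fun i => (hT.eigenvalues i : ℂ)) *
            (hT.eigenvectorUnitary : Matrix (Fin n) (Fin n) ℂ)ᴴ) *
            (hT.eigenvectorUnitary : Matrix (Fin n) (Fin n) ℂ) := congrArg (· * _) h0
        _ = _ := by rw [Matrix.mul_assoc, hV, Matrix.mul_one]
    rw [uhlW, uhlW, Matrix.mul_assoc, Matrix.mul_assoc, h1]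
    simp only [Matrix.mul_assoc]
  rw [h, mul_diagonal, mul_comm]

lemma uhl_attained {n : ℕ} {S T : Matrix (Fin n) (Fin n) ℂ} (hS : S.PosSemidef)
    (hT : T.PosDef) (ρ : ℝ) (hρ : 0 < ρ) (y z : Matrix (Fin n) (Fin n) ℂ) (h : y + z = 1)
    (hyz : S * y = (ρ : ℂ) • (z * T)) :
    (S * (y * yᴴ)).trace + ρ * (T * (zᴴ * z)).trace =
    ((∑ p : Fin n × Fin n, ρ * hS.1.eigenvalues p.1 * hT.posSemidef.1.eigenvalues p.2 /
      (hS.1.eigenvalues p.1 + ρ * hT.posSemidef.1.eigenvalues p.2) *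
        Complex.normSq (uhlW hS.1 hT.posSemidef.1 1 p.1 p.2) : ℝ) : ℂ) := by
  rw [uhl_quad hS.1 hT.posSemidef.1, Complex.ofReal_inj, ← h, uhlW_add]
  refine Finset.sum_congr rfl fun p _ => ?_
  have h1 := uhlW_left hS.1 hT.posSemidef.1 y p.1 p.2
  have h2 := uhlW_right hS.1 hT.posSemidef.1 z p.1 p.2
  have h3 : uhlW hS.1 hT.posSemidef.1 (S * y) =
      (ρ : ℂ) • uhlW hS.1 hT.posSemidef.1 (z * T) := by
    rw [hyz]; simp [uhlW]
  rw [h3, Matrix.smul_apply, h2, smul_eq_mul] at h1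
  have := uhl_eq (hS.1.eigenvalues p.1) (ρ * hT.posSemidef.1.eigenvalues p.2)
    (hS.eigenvalues_nonneg _) (mul_pos hρ (hT.eigenvalues_pos _))
    (uhlW hS.1 hT.posSemidef.1 y p.1 p.2) (uhlW hS.1 hT.posSemidef.1 z p.1 p.2)
    (by rw [← h1]; push_cast; ring)
  rw [this, Matrix.add_apply]
  ring

/-- Solving the minimisation inside the algebra. -/
lemma uhl_solve {n : ℕ} (A : StarSubalgebra ℂ (Matrix (Fin n) (Fin n) ℂ)) (S T : A)
    (hS : (↑S : Matrix (Fin n) (Fin n) ℂ).PosSemidef)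
    (hT : (↑T : Matrix (Fin n) (Fin n) ℂ).PosDef) (ρ : ℝ) (hρ : 0 < ρ) :
    ∃ y : A, S * y + (ρ : ℂ) • (y * T) = (ρ : ℂ) • T := by
  let Φ : A →ₗ[ℂ] A := LinearMap.mulLeft ℂ S + (ρ : ℂ) • LinearMap.mulRight ℂ T
  have : FiniteDimensional ℂ A :=
    inferInstanceAs (FiniteDimensional ℂ (Subalgebra.toSubmodule A.toSubalgebra))
  have hinj : Function.Injective Φ := by
    rw [← LinearMap.ker_eq_bot, LinearMap.ker_eq_bot']
    intro y hy
    have hy' : (S : Matrix (Fin n) (Fin n) ℂ) * (y : Matrix (Fin n) (Fin n) ℂ) +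
        (ρ : ℂ) • ((y : Matrix (Fin n) (Fin n) ℂ) * (T : Matrix (Fin n) (Fin n) ℂ)) = 0 := by
      have := congrArg (fun a : A => (a : Matrix (Fin n) (Fin n) ℂ)) hy
      simpa [Φ] using this
    obtain ⟨y, hyA⟩ := y
    simp only at hy'
    have hW : uhlW hS.1 hT.posSemidef.1 y = 0 := by
      ext i j
      have h1 := uhlW_left hS.1 hT.posSemidef.1 y i j
      have h2 := uhlW_right hS.1 hT.posSemidef.1 y i j
      have h3 := congrArg (fun M => uhlW hS.1 hT.posSemidef.1 M i j) hy'
      simp only [uhlW_add, Matrix.add_apply] at h3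
      have h4 : uhlW hS.1 hT.posSemidef.1 ((ρ : ℂ) • (y * (T : Matrix (Fin n) (Fin n) ℂ))) i j =
        (ρ : ℂ) * uhlW hS.1 hT.posSemidef.1 (y * (T : Matrix (Fin n) (Fin n) ℂ)) i j := by
        simp [uhlW]
      rw [h4, h1, h2] at h3
      have h5 : uhlW hS.1 hT.posSemidef.1 0 i j = 0 := by simp [uhlW]
      rw [h5] at h3
      have h6 : ((hS.1.eigenvalues i + ρ * hT.posSemidef.1.eigenvalues j : ℝ) : ℂ) *
          uhlW hS.1 hT.posSemidef.1 y i j = 0 := by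
        refine Eq.trans ?_ h3
        push_cast; ring
      rcases mul_eq_zero.mp h6 with h7 | h7
      · exfalso
        have h8 : hS.1.eigenvalues i + ρ * hT.posSemidef.1.eigenvalues j = 0 := by
          exact_mod_cast h7
        have := hS.eigenvalues_nonneg i
        have := mul_pos hρ (hT.eigenvalues_pos j)
        linarith
      · simpa using h7
    have hq := uhl_trace hS.1 hT.posSemidef.1 (fun _ => 1) (fun _ => 1) y
    rw [uhl_cfc_one, uhl_cfc_one, hW] at hq
    have : y = 0 := by
      rw [← Matrix.trace_mul_conjTranspose_self_eq_zero_iff]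
      simpa using hq
    exact Subtype.ext this
  obtain ⟨y, hy⟩ := (LinearMap.injective_iff_surjective.mp hinj) ((ρ : ℂ) • T)
  exact ⟨y, by simpa [Φ] using hy⟩

/-- Kadison–Schwarz for unital completely positive maps. -/
lemma uhl_schwarz {n m : ℕ}
    {A₁ : StarSubalgebra ℂ (Matrix (Fin n) (Fin n) ℂ)}
    {A₂ : StarSubalgebra ℂ (Matrix (Fin m) (Fin m) ℂ)}
    (β : A₁ →ₗ[ℂ] A₂) (hβ1 : β 1 = 1) (hβcp : IsCompletelyPositive β) (y : A₁) :
    (↑(β (star y)) : Matrix (Fin m) (Fin m) ℂ) = (↑(β y) : Matrix (Fin m) (Fin m) ℂ)ᴴ ∧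
    ((↑(β (y * star y)) : Matrix (Fin m) (Fin m) ℂ) -
      (↑(β y) : Matrix (Fin m) (Fin m) ℂ) * (↑(β y) : Matrix (Fin m) (Fin m) ℂ)ᴴ).PosSemidef := by
  let M : Matrix (Fin 2) (Fin 2) A₁ := !![1, star y; y, y * star y]
  have hM : (toBig M).PosSemidef := by
    let C : Matrix (Fin 2 × Fin n) (Fin n) ℂ :=
      fun p j => (![1, (y : Matrix (Fin n) (Fin n) ℂ)] p.1) p.2 j
    have : toBig M = C * Cᴴ := by
      ext ⟨a, i⟩ ⟨b, j⟩
      have : (C * Cᴴ) (a, i) (b, j) = ((![1, (y : Matrix (Fin n) (Fin n) ℂ)] a) *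
        (![1, (y : Matrix (Fin n) (Fin n) ℂ)] b)ᴴ) i j := by
        simp only [Matrix.mul_apply, conjTranspose_apply]
        rfl
      rw [this]
      fin_cases a <;> fin_cases b <;> simp [toBig, M, star_eq_conjTranspose]
    rw [this]
    exact posSemidef_self_mul_conjTranspose C
  have hN := hβcp 2 M hM
  set N := toBig (M.map fun a => β a) with hNdef
  have N00 : ∀ i j, N (0, i) (0, j) = (1 : Matrix (Fin m) (Fin m) ℂ) i j := by
    intro i j; simp [N, toBig, M, hβ1]
  have N01 : ∀ i j, N (0, i) (1, j) = (↑(β (star y)) : Matrix (Fin m) (Fin m) ℂ) i j := by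
    intro i j; simp [N, toBig, M]
  have N10 : ∀ i j, N (1, i) (0, j) = (↑(β y) : Matrix (Fin m) (Fin m) ℂ) i j := by
    intro i j; simp [N, toBig, M]
  have N11 : ∀ i j, N (1, i) (1, j) = (↑(β (y * star y)) : Matrix (Fin m) (Fin m) ℂ) i j := by
    intro i j; simp [N, toBig, M]
  have hstar : (↑(β (star y)) : Matrix (Fin m) (Fin m) ℂ) =
      (↑(β y) : Matrix (Fin m) (Fin m) ℂ)ᴴ := by
    ext i j
    rw [conjTranspose_apply, ← N01, ← N10, hN.1.apply]
  refine ⟨hstar, ?_⟩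
  let B : Matrix (Fin m) (Fin 2 × Fin m) ℂ :=
    fun i p => (![-(↑(β y) : Matrix (Fin m) (Fin m) ℂ), 1] p.1) i p.2
  have hB := hN.mul_mul_conjTranspose_same B
  convert hB using 1
  have e1 : B * N = fun i p => (![0, (↑(β (y * star y)) : Matrix (Fin m) (Fin m) ℂ) -
      (↑(β y) : Matrix (Fin m) (Fin m) ℂ) * (↑(β y) : Matrix (Fin m) (Fin m) ℂ)ᴴ] p.1) i p.2 := by
    ext i ⟨b, j⟩
    rw [Matrix.mul_apply, Fintype.sum_prod_type, Fin.sum_univ_two]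
    have hb : b = 0 ∨ b = 1 := by fin_cases b <;> simp
    rcases hb with rfl | rfl
    · simp only [N00, N10, B]
      have h1 := (Matrix.mul_apply (M := -(↑(β y) : Matrix (Fin m) (Fin m) ℂ)) (N := 1)
        (i := i) (k := j))
      have h2 := (Matrix.mul_apply (M := (1 : Matrix (Fin m) (Fin m) ℂ))
        (N := (↑(β y) : Matrix (Fin m) (Fin m) ℂ)) (i := i) (k := j))
      simp only [Matrix.cons_val_zero, Matrix.cons_val_one]
      rw [← h1, ← h2]
      simp
    · simp only [N01, N11, B]
      have h1 := (Matrix.mul_apply (M := -(↑(β y) : Matrix (Fin m) (Fin m) ℂ))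
        (N := (↑(β (star y)) : Matrix (Fin m) (Fin m) ℂ)) (i := i) (k := j))
      have h2 := (Matrix.mul_apply (M := (1 : Matrix (Fin m) (Fin m) ℂ))
        (N := (↑(β (y * star y)) : Matrix (Fin m) (Fin m) ℂ)) (i := i) (k := j))
      simp only [Matrix.cons_val_zero, Matrix.cons_val_one]
      rw [← h1, ← h2, hstar]
      simp only [Matrix.neg_mul, Matrix.neg_apply, Matrix.one_mul, Matrix.sub_apply]
      ring
  ext i j
  rw [Matrix.mul_apply (M := B * N), e1, Fintype.sum_prod_type, Fin.sum_univ_two]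
  have hB1 : ∀ x, Bᴴ (1, x) j = (1 : Matrix (Fin m) (Fin m) ℂ) x j := by
    intro x
    rw [conjTranspose_apply]
    change star ((1 : Matrix (Fin m) (Fin m) ℂ) j x) = _
    rw [← conjTranspose_apply, conjTranspose_one]
  simp only [hB1, Matrix.cons_val_zero, Matrix.cons_val_one, Matrix.zero_apply, zero_mul,
    Finset.sum_const_zero, zero_add]
  rw [← Matrix.mul_apply, Matrix.mul_one]

lemma uhl_trace_nonneg {n : ℕ} {S P : Matrix (Fin n) (Fin n) ℂ} (hS : S.PosSemidef)
    (hP : P.PosSemidef) : 0 ≤ (S * P).trace := by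
  obtain ⟨B, rfl⟩ : ∃ B : Matrix (Fin n) (Fin n) ℂ, P = Bᴴ * B := by
    open scoped MatrixOrder in
    exact CStarAlgebra.nonneg_iff_eq_star_mul_self.mp hP.nonneg
  rw [← Matrix.mul_assoc, trace_mul_comm, ← Matrix.mul_assoc]
  exact (hS.mul_mul_conjTranspose_same B).trace_nonneg

lemma uhl_rho {n m : ℕ}
    (A₁ : StarSubalgebra ℂ (Matrix (Fin n) (Fin n) ℂ))
    (A₂ : StarSubalgebra ℂ (Matrix (Fin m) (Fin m) ℂ))
    (β : A₁ →ₗ[ℂ] A₂) (hβ1 : β 1 = 1) (hβcp : IsCompletelyPositive β)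
    (S₁ T₁ : A₁) (S₂ T₂ : A₂)
    (hS₁ : (↑S₁ : Matrix (Fin n) (Fin n) ℂ).PosSemidef)
    (hT₁ : (↑T₁ : Matrix (Fin n) (Fin n) ℂ).PosDef)
    (hS₂ : (↑S₂ : Matrix (Fin m) (Fin m) ℂ).PosSemidef)
    (hT₂ : (↑T₂ : Matrix (Fin m) (Fin m) ℂ).PosDef)
    (hS : ∀ a : A₁, (↑a : Matrix (Fin n) (Fin n) ℂ).PosSemidef →
      ((↑S₂ : Matrix (Fin m) (Fin m) ℂ) * (↑(β a) : Matrix (Fin m) (Fin m) ℂ)).trace ≤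
        ((↑S₁ : Matrix (Fin n) (Fin n) ℂ) * (↑a : Matrix (Fin n) (Fin n) ℂ)).trace)
    (hT : ∀ a : A₁, (↑a : Matrix (Fin n) (Fin n) ℂ).PosSemidef →
      ((↑T₂ : Matrix (Fin m) (Fin m) ℂ) * (↑(β a) : Matrix (Fin m) (Fin m) ℂ)).trace ≤
        ((↑T₁ : Matrix (Fin n) (Fin n) ℂ) * (↑a : Matrix (Fin n) (Fin n) ℂ)).trace)  
    (ρ : ℝ) (hρ : 0 < ρ) :
    ∑ p : Fin m × Fin m, ρ * hS₂.1.eigenvalues p.1 * hT₂.posSemidef.1.eigenvalues p.2 /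
      (hS₂.1.eigenvalues p.1 + ρ * hT₂.posSemidef.1.eigenvalues p.2) *
        Complex.normSq (uhlW hS₂.1 hT₂.posSemidef.1 1 p.1 p.2) ≤
    ∑ p : Fin n × Fin n, ρ * hS₁.1.eigenvalues p.1 * hT₁.posSemidef.1.eigenvalues p.2 /
      (hS₁.1.eigenvalues p.1 + ρ * hT₁.posSemidef.1.eigenvalues p.2) *
        Complex.normSq (uhlW hS₁.1 hT₁.posSemidef.1 1 p.1 p.2) := by
  obtain ⟨y, hy⟩ := uhl_solve A₁ S₁ T₁ hS₁ hT₁ ρ hρ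
  set z : A₁ := 1 - y with hz
  have hyz : y + z = 1 := by rw [hz]; abel
  have hyz' : S₁ * y = (ρ : ℂ) • (z * T₁) := by
    rw [hz, sub_mul, one_mul, smul_sub, ← hy]; abel
  have hat := uhl_attained hS₁ hT₁ ρ hρ (y : Matrix (Fin n) (Fin n) ℂ) z
    (by simpa using congrArg (fun a : A₁ => (a : Matrix (Fin n) (Fin n) ℂ)) hyz)
    (by simpa using congrArg (fun a : A₁ => (a : Matrix (Fin n) (Fin n) ℂ)) hyz')
  have hlo := uhl_lower hS₂ hT₂ ρ hρ (β y : Matrix (Fin m) (Fin m) ℂ) (β z)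
    (by
      have : β y + β z = 1 := by rw [← map_add, hyz, hβ1]
      simpa using congrArg (fun a : A₂ => (a : Matrix (Fin m) (Fin m) ℂ)) this)
  rw [← Complex.real_le_real]
  refine hlo.trans (le_trans ?_ (le_of_eq hat))
  have sy := uhl_schwarz β hβ1 hβcp y
  have sz := uhl_schwarz β hβ1 hβcp (star z)
  have sz0 := (uhl_schwarz β hβ1 hβcp z).1
  have iy : ((S₂ : Matrix (Fin m) (Fin m) ℂ) *
      ((β y : Matrix (Fin m) (Fin m) ℂ) * (β y : Matrix (Fin m) (Fin m) ℂ)ᴴ)).trace ≤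
      ((S₁ : Matrix (Fin n) (Fin n) ℂ) *
      ((y : Matrix (Fin n) (Fin n) ℂ) * (y : Matrix (Fin n) (Fin n) ℂ)ᴴ)).trace := by
    have a1 := uhl_trace_nonneg hS₂ sy.2
    rw [Matrix.mul_sub, trace_sub, sub_nonneg] at a1
    have a2 := hS (y * star y)
      (by simpa [star_eq_conjTranspose] using
        posSemidef_self_mul_conjTranspose (y : Matrix (Fin n) (Fin n) ℂ))
    exact a1.trans (by simpa [star_eq_conjTranspose] using a2)
  have iz : ((T₂ : Matrix (Fin m) (Fin m) ℂ) *
      ((β z : Matrix (Fin m) (Fin m) ℂ)ᴴ * (β z : Matrix (Fin m) (Fin m) ℂ))).trace ≤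
      ((T₁ : Matrix (Fin n) (Fin n) ℂ) *
      ((z : Matrix (Fin n) (Fin n) ℂ)ᴴ * (z : Matrix (Fin n) (Fin n) ℂ))).trace := by
    have a1 := uhl_trace_nonneg hT₂.posSemidef sz.2
    rw [Matrix.mul_sub, trace_sub, sub_nonneg, sz0, conjTranspose_conjTranspose, star_star] at a1
    have a2 := hT (star z * z)
      (by
        have := posSemidef_conjTranspose_mul_self (z : Matrix (Fin n) (Fin n) ℂ)
        rw [← star_eq_conjTranspose] at this
        exact this)
    exact a1.trans a2
  exact add_le_add iy (mul_le_mul_of_nonneg_left iz (by exact_mod_cast hρ.le))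

end UhlmannAux

/-- Under the hypotheses of Uhlmann's lemma (`β` unital completely positive,
`tr(S₂ β(a)) ≤ tr(S₁ a)` and `tr(T₂ β(a)) ≤ tr(T₁ a)` for all positive `a`, with the
`Tᵢ` positive definite), one has `tr(S₂^μ T₂^{1-μ}) ≤ tr(S₁^μ T₁^{1-μ})` for `0 ≤ μ ≤ 1`. -/
theorem uhlmann_lemma_power_trace {n m : ℕ}
    (A₁ : StarSubalgebra ℂ (Matrix (Fin n) (Fin n) ℂ))
    (A₂ : StarSubalgebra ℂ (Matrix (Fin m) (Fin m) ℂ))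
    (β : A₁ →ₗ[ℂ] A₂) (hβ1 : β 1 = 1) (hβcp : IsCompletelyPositive β)
    (S₁ T₁ : A₁) (S₂ T₂ : A₂)
    (hS₁ : (↑S₁ : Matrix (Fin n) (Fin n) ℂ).PosSemidef)
    (hT₁ : (↑T₁ : Matrix (Fin n) (Fin n) ℂ).PosDef)
    (hS₂ : (↑S₂ : Matrix (Fin m) (Fin m) ℂ).PosSemidef)
    (hT₂ : (↑T₂ : Matrix (Fin m) (Fin m) ℂ).PosDef)
    (hS : ∀ a : A₁, (↑a : Matrix (Fin n) (Fin n) ℂ).PosSemidef →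
      ((↑S₂ : Matrix (Fin m) (Fin m) ℂ) * (↑(β a) : Matrix (Fin m) (Fin m) ℂ)).trace ≤
        ((↑S₁ : Matrix (Fin n) (Fin n) ℂ) * (↑a : Matrix (Fin n) (Fin n) ℂ)).trace)
    (hT : ∀ a : A₁, (↑a : Matrix (Fin n) (Fin n) ℂ).PosSemidef →
      ((↑T₂ : Matrix (Fin m) (Fin m) ℂ) * (↑(β a) : Matrix (Fin m) (Fin m) ℂ)).trace ≤
        ((↑T₁ : Matrix (Fin n) (Fin n) ℂ) * (↑a : Matrix (Fin n) (Fin n) ℂ)).trace) :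
    ∀ μ : ℝ, 0 ≤ μ → μ ≤ 1 →
      (hS₂.1.cfc (fun r : ℝ => r ^ μ) * hT₂.posSemidef.1.cfc (fun r : ℝ => r ^ (1 - μ))).trace ≤
      (hS₁.1.cfc (fun r : ℝ => r ^ μ) * hT₁.posSemidef.1.cfc (fun r : ℝ => r ^ (1 - μ))).trace := by
  intro μ h0 h1
  have tr2 : ∀ {k : ℕ} {S T : Matrix (Fin k) (Fin k) ℂ} (hS : S.IsHermitian) (hT : T.IsHermitian)
      (f g : ℝ → ℝ), (hS.cfc f * hT.cfc g).trace =
      ((∑ p : Fin k × Fin k, f (hS.eigenvalues p.1) * g (hT.eigenvalues p.2) *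
        Complex.normSq (uhlW hS hT 1 p.1 p.2) : ℝ) : ℂ) := by
    intro k S T hS hT f g
    have := uhl_trace hS hT f g 1
    simpa using this
  rcases h0.eq_or_lt with rfl | h0
  · have := hT 1 (by simpa using Matrix.PosSemidef.one)
    simpa [hβ1, uhl_cfc_one, uhl_cfc_id] using this
  rcases h1.eq_or_lt with rfl | h1
  · have := hS 1 (by simpa using Matrix.PosSemidef.one)
    simpa [hβ1, uhl_cfc_one, uhl_cfc_id] using this
  rw [tr2, tr2, Complex.real_le_real]
  exact uhl_scalar (fun p : Fin m × Fin m => hS₂.1.eigenvalues p.1)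
    (fun p => hT₂.posSemidef.1.eigenvalues p.2)
    (fun p => Complex.normSq (uhlW hS₂.1 hT₂.posSemidef.1 1 p.1 p.2))
    (fun p : Fin n × Fin n => hS₁.1.eigenvalues p.1)
    (fun p => hT₁.posSemidef.1.eigenvalues p.2)
    (fun p => Complex.normSq (uhlW hS₁.1 hT₁.posSemidef.1 1 p.1 p.2))
    (fun p => hS₂.eigenvalues_nonneg p.1)
    (fun p => hT₂.eigenvalues_pos p.2) (fun p => hS₁.eigenvalues_nonneg p.1)
    (fun p => hT₁.eigenvalues_pos p.2)
    (uhl_rho A₁ A₂ β hβ1 hβcp S₁ T₁ S₂ T₂ hS₁ hT₁ hS₂ hT₂ hS hT) ⟨h0, h1⟩
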